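/- arXiv:2409.17375 — 5 statements merged into one kernel-verified Lean document; each statement's English description precedes it below -/
import Mathlib

section
/- For every integer n ≥ 1, the even dihedral Artin group D_{2n} = ⟨a, b | (a,b)_{2n} = (b,a)_{2n}⟩ is isomorphic to the one-relator group ⟨a, x | a x^n = x^n a⟩, via an isomorphism given on generators by a ↦ a and sending x to the image of ab. -/
/-- The alternating product `u v u v …` of length `m`. -/
def altProd {G : Type*} [Monoid G] (u v : G) (m : ℕ) : G :=
  ((List.range m).map (fun i => if i % 2 = 0 then u else v)).prod

/-- Relations of the Artin group of an Artin graph `(G, ℓ)`: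
`(u,v)_{ℓ u v} = (v,u)_{ℓ u v}` for each edge `{u,v}`. -/
def artinRels {V : Type*} (G : SimpleGraph V) (ℓ : V → V → ℕ) : Set (FreeGroup V) :=
  {r | ∃ u v : V, G.Adj u v ∧
    r = altProd (FreeGroup.of u) (FreeGroup.of v) (ℓ u v) *
        (altProd (FreeGroup.of v) (FreeGroup.of u) (ℓ u v))⁻¹}

/-- The Artin group of an Artin graph `(G, ℓ)`. -/
abbrev ArtinGroup {V : Type*} (G : SimpleGraph V) (ℓ : V → V → ℕ) :=
  PresentedGroup (artinRels G ℓ)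

/-- The dihedral Artin group `D_m = ⟨a, b ∣ (a,b)_m = (b,a)_m⟩`, as the Artin group of a
single edge labeled `m`; the generator `a` is `PresentedGroup.of 0`, and `b` is
`PresentedGroup.of 1`. -/
abbrev DihedralArtin (m : ℕ) : Type :=
  ArtinGroup (⊤ : SimpleGraph (Fin 2)) (fun _ _ => m)

/-- The one-relator group `⟨a, x ∣ a xⁿ = xⁿ a⟩`; the generator `a` is `PresentedGroup.of 0`
and `x` is `PresentedGroup.of 1`. -/
def oneRelRels (n : ℕ) : Set (FreeGroup (Fin 2)) :=
  {FreeGroup.of 0 * (FreeGroup.of 1) ^ n * (FreeGroup.of 0)⁻¹ * ((FreeGroup.of 1) ^ n)⁻¹}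

theorem altProd_even {G : Type*} [Monoid G] (u v : G) (n : ℕ) :
    altProd u v (2 * n) = (u * v) ^ n := by
  induction n with
  | zero => simp [altProd]
  | succ k ih =>
    unfold altProd at ih ⊢
    have h1 : (2 * k + 1) % 2 = 1 := by omega
    rw [show 2 * (k + 1) = 2 * k + 1 + 1 by ring, List.range_succ, List.range_succ, pow_succ, ← ih]
    simp [h1]

theorem swap_pow {G : Type*} [Group G] (u v : G) (n : ℕ) :
    (v * u) ^ n = u⁻¹ * (u * v) ^ n * u := by
  have h : v * u = u⁻¹ * (u * v) * (u⁻¹)⁻¹ := by group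
  rw [h, conj_pow, inv_inv]

theorem artin_lift_rel {G : Type*} [Group G] (n : ℕ) (f : Fin 2 → G)
    (h : (f 0 * f 1) ^ n = (f 1 * f 0) ^ n) :
    ∀ r ∈ artinRels (⊤ : SimpleGraph (Fin 2)) (fun _ _ => 2 * n), FreeGroup.lift f r = 1 := by
  rintro r ⟨u, v, huv, rfl⟩
  simp only [altProd_even, map_mul, map_inv, map_pow, FreeGroup.lift_apply_of]
  rw [mul_inv_eq_one]
  fin_cases u <;> fin_cases v
  · simp at huv
  · exact h
  · exact h.symm
  · simp at huv

theorem oneRel_comm (n : ℕ) :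
    (PresentedGroup.of 0 : PresentedGroup (oneRelRels n)) * PresentedGroup.of 1 ^ n
      = PresentedGroup.of 1 ^ n * PresentedGroup.of 0 := by
  have h := PresentedGroup.one_of_mem (rels := oneRelRels n) (Set.mem_singleton _)
  simp only [map_mul, map_inv, map_pow] at h
  rw [mul_inv_eq_one, mul_inv_eq_iff_eq_mul] at h
  exact h

theorem dihedral_rel (n : ℕ) :
    ((PresentedGroup.of 0 : DihedralArtin (2 * n)) * PresentedGroup.of 1) ^ n
      = (PresentedGroup.of 1 * PresentedGroup.of 0) ^ n := by
  have h := PresentedGroup.one_of_mem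
    (rels := artinRels (⊤ : SimpleGraph (Fin 2)) (fun _ _ => 2 * n))
    ⟨0, 1, by simp, rfl⟩
  simp only [altProd_even, map_mul, map_inv, map_pow] at h
  rw [mul_inv_eq_one] at h
  exact h

/-- For `n ≥ 1`, the even dihedral Artin group `D_{2n}` is isomorphic to
`⟨a, x ∣ a xⁿ = xⁿ a⟩` via `a ↦ a`, `ab ↦ x`. -/
theorem stmt_1 (n : ℕ) (hn : 1 ≤ n) :
    ∃ e : DihedralArtin (2 * n) ≃* PresentedGroup (oneRelRels n),
      e (PresentedGroup.of 0) = PresentedGroup.of 0 ∧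
      e (PresentedGroup.of 0 * PresentedGroup.of 1) = PresentedGroup.of 1 := by
  let P := PresentedGroup (oneRelRels n)
  let F : DihedralArtin (2 * n) →* P := PresentedGroup.toGroup
    (f := ![PresentedGroup.of 0, (PresentedGroup.of 0)⁻¹ * PresentedGroup.of 1])
    (artin_lift_rel n _ (by
      conv_rhs => rw [swap_pow]
      simp only [Matrix.cons_val_zero, Matrix.cons_val_one, mul_inv_cancel_left]
      rw [mul_assoc, ← oneRel_comm, inv_mul_cancel_left]))
  let H : P →* DihedralArtin (2 * n) := PresentedGroup.toGroup
    (f := ![PresentedGroup.of 0, PresentedGroup.of 0 * PresentedGroup.of 1])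
    (by
      intro r hr
      rw [oneRelRels, Set.mem_singleton_iff] at hr
      subst hr
      simp only [map_mul, map_inv, map_pow, FreeGroup.lift_apply_of,
        Matrix.cons_val_zero, Matrix.cons_val_one]
      have h := dihedral_rel n
      replace h := h.trans (swap_pow _ _ n)
      rw [mul_inv_eq_one, mul_inv_eq_iff_eq_mul]
      rw [mul_assoc, eq_inv_mul_iff_mul_eq] at h
      exact h)
  have F0 : F (PresentedGroup.of 0) = PresentedGroup.of 0 := PresentedGroup.toGroup.of _
  have F1 : F (PresentedGroup.of 1) = (PresentedGroup.of 0)⁻¹ * PresentedGroup.of 1 :=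
    PresentedGroup.toGroup.of _
  have H0 : H (PresentedGroup.of 0) = PresentedGroup.of 0 := PresentedGroup.toGroup.of _
  have H1 : H (PresentedGroup.of 1) = PresentedGroup.of 0 * PresentedGroup.of 1 :=
    PresentedGroup.toGroup.of _
  have HF : H.comp F = MonoidHom.id _ := by
    apply PresentedGroup.ext
    intro i
    fin_cases i
    · change H (F (PresentedGroup.of 0)) = PresentedGroup.of 0
      rw [F0, H0]
    · change H (F (PresentedGroup.of 1)) = PresentedGroup.of 1
      rw [F1, map_mul, map_inv, H0, H1, inv_mul_cancel_left]
  have FH : F.comp H = MonoidHom.id _ := by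
    apply PresentedGroup.ext
    intro i
    fin_cases i
    · change F (H (PresentedGroup.of 0)) = PresentedGroup.of 0
      rw [H0, F0]
    · change F (H (PresentedGroup.of 1)) = PresentedGroup.of 1
      rw [H1, map_mul, F0, F1, mul_inv_cancel_left]
  refine ⟨MonoidHom.toMulEquiv F H HF FH, F0, ?_⟩
  change F (PresentedGroup.of 0 * PresentedGroup.of 1) = PresentedGroup.of 1
  rw [map_mul, F0, F1, mul_inv_cancel_left]
end

section
/- Let n ≥ 1 and let G = ⟨a, x | a x^n = x^n a⟩. Then the subgroup H_n of G generated by the n+1 elements x^n, a, xax^{-1}, …, x^{n-1} a x^{-(n-1)} is a normal subgroup of index n in G, and H_n is isomorphic to F_n × ℤ, the direct product of a free group of rank n and the infinite cyclic group, with x^n corresponding to a generator of the central ℤ factor and the elements x^i a x^{-i} (0 ≤ i ≤ n-1) corresponding to a basis of the free factor F_n. -/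
/-- In `G = ⟨a, x ∣ a xⁿ = xⁿ a⟩` (`n ≥ 1`), the subgroup `Hₙ` generated by
`xⁿ, a, xax⁻¹, …, xⁿ⁻¹ax⁻⁽ⁿ⁻¹⁾` is normal of index `n`, and `Hₙ ≅ Fₙ × ℤ` with `xⁿ`
corresponding to a generator of the central `ℤ` factor and `xⁱax⁻ⁱ` to a basis of `Fₙ`. -/
theorem stmt_2 (n : ℕ) (hn : 1 ≤ n)
    (a x : PresentedGroup (oneRelRels n))
    (ha : a = PresentedGroup.of 0) (hx : x = PresentedGroup.of 1)
    (H : Subgroup (PresentedGroup (oneRelRels n)))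
    (hH : H = Subgroup.closure
      ({x ^ n} ∪ Set.range (fun i : Fin n => x ^ (i : ℕ) * a * (x ^ (i : ℕ))⁻¹))) :
    H.Normal ∧ H.index = n ∧
    ∃ e : H ≃* FreeGroup (Fin n) × Multiplicative ℤ,
      ((e.symm (1, Multiplicative.ofAdd 1) : H) : PresentedGroup (oneRelRels n)) = x ^ n ∧
      ∀ i : Fin n,
        ((e.symm (FreeGroup.of i, 1) : H) : PresentedGroup (oneRelRels n)) =
          x ^ (i : ℕ) * a * (x ^ (i : ℕ))⁻¹ := by
  obtain ⟨m, rfl⟩ : ∃ m, n = m + 1 := ⟨n - 1, by omega⟩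
  -- the basic relation
  have hcomm : Commute a (x ^ (m + 1)) := by
    have h1 : (PresentedGroup.mk (oneRelRels (m + 1)))
        (FreeGroup.of 0 * (FreeGroup.of 1) ^ (m + 1) * (FreeGroup.of 0)⁻¹
          * ((FreeGroup.of 1) ^ (m + 1))⁻¹) = 1 :=
      PresentedGroup.one_of_mem (by simp [oneRelRels])
    simp only [map_mul, map_inv, map_pow] at h1
    change PresentedGroup.of 0 * (PresentedGroup.of 1) ^ (m + 1) * (PresentedGroup.of 0)⁻¹
          * ((PresentedGroup.of 1) ^ (m + 1))⁻¹ = 1 at h1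
    rw [← ha, ← hx] at h1
    have h2 := mul_inv_eq_one.mp h1
    exact mul_inv_eq_iff_eq_mul.mp h2
  -- the central generator and conjugates
  have hxn : x ^ (m + 1) ∈ H := by
    rw [hH]; exact Subgroup.subset_closure (Or.inl rfl)
  have hb : ∀ i : Fin (m + 1), x ^ (i : ℕ) * a * (x ^ (i : ℕ))⁻¹ ∈ H := by
    intro i
    rw [hH]; exact Subgroup.subset_closure (Or.inr ⟨i, rfl⟩)
  have hsplit : ∀ k : ℤ, ∃ (q : ℤ) (r : Fin (m + 1)),
      x ^ k = x ^ (r : ℕ) * (x ^ (m + 1)) ^ q := by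
    intro k
    have hpos : (0 : ℤ) < ((m + 1 : ℕ) : ℤ) := by positivity
    have h0 := Int.emod_nonneg k hpos.ne'
    have h1 := Int.emod_lt_of_pos k hpos
    refine ⟨k / ((m + 1 : ℕ) : ℤ), ⟨(k % ((m + 1 : ℕ) : ℤ)).toNat, by omega⟩, ?_⟩
    rw [← zpow_natCast x (m + 1), ← zpow_mul, ← zpow_natCast, ← zpow_add]
    congr 1
    simp only [Int.toNat_of_nonneg h0]
    exact (Int.emod_add_mul_ediv k _).symm
  have hconj_a : ∀ k : ℤ, x ^ k * a * (x ^ k)⁻¹ ∈ H := by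
    intro k
    obtain ⟨q, r, hk⟩ := hsplit k
    have : x ^ k * a * (x ^ k)⁻¹ = x ^ (r : ℕ) * a * (x ^ (r : ℕ))⁻¹ := by
      rw [hk, mul_assoc (x ^ (r : ℕ)), ← (hcomm.zpow_right q).eq]
      group
    rw [this]; exact hb r
  have hconj : ∀ (k : ℤ) (h), h ∈ H → x ^ k * h * (x ^ k)⁻¹ ∈ H := by
    intro k h hh
    rw [hH] at hh
    induction hh using Subgroup.closure_induction with
    | mem y hy =>
      rcases hy with hy | ⟨i, rfl⟩
      · rw [Set.mem_singleton_iff.mp hy]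
        have : x ^ k * x ^ (m + 1) * (x ^ k)⁻¹ = x ^ (m + 1) := by
          rw [← zpow_natCast x (m + 1), ← zpow_add, ← zpow_neg, ← zpow_add]
          congr 1; ring
        rw [this]; exact hxn
      · have := hconj_a (k + ((i : ℕ) : ℤ))
        rw [zpow_add, zpow_natCast] at this
        simpa [mul_assoc] using this
    | one => simp
    | mul y z _ _ hy hz =>
      have := H.mul_mem hy hz
      simpa [mul_assoc] using this
    | inv y _ hy =>
      have := H.inv_mem hy
      simpa [mul_assoc] using this
  have hall : ∀ g : PresentedGroup (oneRelRels (m + 1)), ∃ h ∈ H, ∃ k : ℤ, g = h * x ^ k := by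
    have haH : a ∈ H := by simpa using hconj_a 0
    intro g
    obtain ⟨w, rfl⟩ := PresentedGroup.mk_surjective _ g
    have h_of : ∀ j : Fin 2, ∃ h ∈ H, ∃ k : ℤ,
        PresentedGroup.mk (oneRelRels (m + 1)) (FreeGroup.of j) = h * x ^ k := by
      intro j
      fin_cases j
      · exact ⟨a, haH, 0, by rw [ha]; simp; rfl⟩
      · exact ⟨1, H.one_mem, 1, by rw [hx]; simp; rfl⟩
    have h_inv : ∀ y : PresentedGroup (oneRelRels (m + 1)),
        (∃ h ∈ H, ∃ k : ℤ, y = h * x ^ k) → ∃ h ∈ H, ∃ k : ℤ, y⁻¹ = h * x ^ k := by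
      rintro y ⟨h, hh, k, rfl⟩
      refine ⟨_, hconj (-k) _ (H.inv_mem hh), -k, ?_⟩
      group
    induction w using FreeGroup.induction_on with
    | C1 => exact ⟨1, H.one_mem, 0, by simp⟩
    | of j => exact h_of j
    | inv_of j _ => rw [map_inv]; exact h_inv _ (h_of j)
    | mul y z hy hz =>
      obtain ⟨h, hh, k, hy⟩ := hy
      obtain ⟨h', hh', k', hz⟩ := hz
      refine ⟨_, H.mul_mem hh (hconj k _ hh'), k + k', ?_⟩
      rw [map_mul, hy, hz]
      group
  -- the map to `ZMod n`
  obtain ⟨f, hfa, hfx⟩ : ∃ f : PresentedGroup (oneRelRels (m + 1)) →*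
      Multiplicative (ZMod (m + 1)), f a = 1 ∧ f x = Multiplicative.ofAdd 1 := by
    refine ⟨PresentedGroup.toGroup (f := ![1, Multiplicative.ofAdd 1]) ?_, ?_, ?_⟩
    · intro r hr
      rw [oneRelRels, Set.mem_singleton_iff] at hr
      subst hr
      simp
    · rw [ha, PresentedGroup.toGroup.of]; rfl
    · rw [hx, PresentedGroup.toGroup.of]; rfl
  have hfxk : ∀ k : ℤ, f (x ^ k) = Multiplicative.ofAdd (k : ZMod (m + 1)) := by
    intro k
    rw [map_zpow, hfx, ← ofAdd_zsmul]; simp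
  have hker : H = f.ker := by
    have hle : H ≤ f.ker := by
      rw [hH, Subgroup.closure_le]
      rintro y (hy | ⟨i, rfl⟩)
      · rw [Set.mem_singleton_iff.mp hy]
        change f _ = 1
        have := hfxk ((m + 1 : ℕ) : ℤ)
        rw [zpow_natCast] at this
        rw [this, Int.cast_natCast, ZMod.natCast_self]; rfl
      · change f _ = 1
        simp [hfa]
    refine le_antisymm hle ?_
    intro g hg
    obtain ⟨h, hh, k, rfl⟩ := hall g
    have h1 : f h = 1 := hle hh
    have h2 : f (h * x ^ k) = 1 := hg
    rw [map_mul, h1, one_mul, hfxk, ofAdd_eq_one, ZMod.intCast_zmod_eq_zero_iff_dvd] at h2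
    obtain ⟨q, rfl⟩ := h2
    rw [zpow_mul, zpow_natCast]
    exact H.mul_mem hh (H.zpow_mem hxn q)
  have hsurj : Function.Surjective f := by
    intro z
    obtain ⟨k, hk⟩ := ZMod.intCast_surjective (Multiplicative.toAdd z)
    exact ⟨x ^ k, by rw [hfxk, hk]; rfl⟩
  refine ⟨hker ▸ f.normal_ker, ?_, ?_⟩
  · rw [hker, Subgroup.index_ker, MonoidHom.range_eq_top.mpr hsurj]
    simp
  -- the isomorphism
  let L : FreeGroup (Fin (m + 1)) →* PresentedGroup (oneRelRels (m + 1)) :=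
    FreeGroup.lift (fun i : Fin (m + 1) => x ^ (i : ℕ) * a * (x ^ (i : ℕ))⁻¹)
  have hLof : ∀ i, L (FreeGroup.of i) = x ^ (i : ℕ) * a * (x ^ (i : ℕ))⁻¹ := fun i => by
    simp [L]
  let Z : Multiplicative ℤ →* PresentedGroup (oneRelRels (m + 1)) :=
    zpowersHom _ (x ^ (m + 1))
  have hZ : ∀ k : Multiplicative ℤ, Z k = (x ^ (m + 1)) ^ (Multiplicative.toAdd k) := fun k => by
    simp [Z, zpowersHom_apply]
  have hxcent : ∀ w, Commute (L w) (x ^ (m + 1)) := by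
    intro w
    have hxx : ∀ i : ℕ, Commute (x ^ i) (x ^ (m + 1)) := fun i =>
      (Commute.refl x).pow_pow i (m + 1)
    have h_of : ∀ i, Commute (L (FreeGroup.of i)) (x ^ (m + 1)) := by
      intro i
      rw [hLof]
      exact ((hxx i).mul_left hcomm).mul_left (hxx i).inv_left
    induction w using FreeGroup.induction_on with
    | C1 => rw [map_one]; exact Commute.one_left _
    | of j => exact h_of j
    | inv_of j _ => rw [map_inv]; exact (h_of j).inv_left
    | mul y z hy hz => rw [map_mul]; exact hy.mul_left hz
  let ψ : FreeGroup (Fin (m + 1)) × Multiplicative ℤ →* PresentedGroup (oneRelRels (m + 1)) :=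
    MonoidHom.noncommCoprod L Z (fun w k => by rw [hZ]; exact (hxcent w).zpow_right _)
  have hψ : ∀ p, ψ p = L p.1 * Z p.2 := fun p => rfl
  have hψx : ψ (1, Multiplicative.ofAdd 1) = x ^ (m + 1) := by
    rw [hψ, map_one, one_mul, hZ]; simp
  have hψb : ∀ i, ψ (FreeGroup.of i, 1) = x ^ (i : ℕ) * a * (x ^ (i : ℕ))⁻¹ := fun i => by
    rw [hψ, map_one, mul_one, hLof]
  have hrange : ψ.range = H := by
    apply le_antisymm
    · rintro _ ⟨⟨w, k⟩, rfl⟩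
      rw [hψ, hZ]
      refine H.mul_mem ?_ (H.zpow_mem hxn _)
      change L w ∈ H
      induction w using FreeGroup.induction_on with
      | C1 => rw [map_one]; exact H.one_mem
      | of j => exact (hLof j) ▸ hb j
      | inv_of j _ => rw [map_inv]; exact H.inv_mem ((hLof j) ▸ hb j)
      | mul y z hy hz => rw [map_mul]; exact H.mul_mem hy hz
    · rw [hH, Subgroup.closure_le]
      rintro y (hy | ⟨i, rfl⟩)
      · rw [Set.mem_singleton_iff.mp hy]; exact ⟨_, hψx⟩
      · exact ⟨_, hψb i⟩
  -- injectivity, through the semidirect product `F ⋊ ℤ` with `ℤ` permuting the basis cyclically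
  have hinj : Function.Injective ψ := by
    open Fin.NatCast Fin.CommRing in
    let σ : MulAut (FreeGroup (Fin (m + 1))) :=
      FreeGroup.freeGroupCongr (Equiv.addRight (1 : Fin (m + 1)))
    have hσ : ∀ (k : ℕ) (i : Fin (m + 1)),
        (σ ^ k) (FreeGroup.of i) = FreeGroup.of (i + (k : Fin (m + 1))) := by
      intro k
      induction k with
      | zero => intro i; simp
      | succ k ih =>
        intro i
        rw [pow_succ', MulAut.mul_apply, ih]
        simp [σ, add_assoc]
    have hσn : σ ^ (m + 1) = 1 := by
      ext w
      have : ((σ ^ (m + 1)).toMonoidHom : _ →* FreeGroup (Fin (m + 1))) = MonoidHom.id _ := by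
        ext i
        change (σ ^ (m + 1)) (FreeGroup.of i) = FreeGroup.of i
        rw [hσ, Fin.natCast_self, add_zero]
      exact DFunLike.congr_fun this w
    let φ : Multiplicative ℤ →* MulAut (FreeGroup (Fin (m + 1))) := zpowersHom _ σ
    have hφ : ∀ k : ℕ, φ (Multiplicative.ofAdd (k : ℤ)) = σ ^ k := fun k => by
      simp [φ, zpowersHom_apply]
    let X : FreeGroup (Fin (m + 1)) ⋊[φ] Multiplicative ℤ :=
      SemidirectProduct.inr (Multiplicative.ofAdd 1)
    let A : FreeGroup (Fin (m + 1)) ⋊[φ] Multiplicative ℤ :=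
      SemidirectProduct.inl (FreeGroup.of 0)
    have hX : ∀ k : ℕ, X ^ k = SemidirectProduct.inr (Multiplicative.ofAdd (k : ℤ)) := by
      intro k
      rw [← map_pow, ← ofAdd_nsmul]; simp
    have hXA : ∀ k : ℕ, X ^ k * A * (X ^ k)⁻¹ =
        SemidirectProduct.inl (FreeGroup.of (k : Fin (m + 1))) := by
      intro k
      rw [hX, ← map_inv, ← SemidirectProduct.inl_aut, hφ, hσ, zero_add]
    obtain ⟨Θ, hΘa, hΘx⟩ : ∃ Θ : PresentedGroup (oneRelRels (m + 1)) →*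
        FreeGroup (Fin (m + 1)) ⋊[φ] Multiplicative ℤ, Θ a = A ∧ Θ x = X := by
      refine ⟨PresentedGroup.toGroup (f := ![A, X]) ?_, ?_, ?_⟩
      · intro r hr
        rw [oneRelRels, Set.mem_singleton_iff] at hr
        subst hr
        have h1 := hXA (m + 1)
        rw [Fin.natCast_self, mul_inv_eq_iff_eq_mul] at h1
        simp only [map_mul, map_inv, map_pow, FreeGroup.lift_apply_of]
        change A * X ^ (m + 1) * A⁻¹ * (X ^ (m + 1))⁻¹ = 1
        rw [mul_inv_eq_one, mul_inv_eq_iff_eq_mul]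
        exact h1.symm
      · rw [ha, PresentedGroup.toGroup.of]; rfl
      · rw [hx, PresentedGroup.toGroup.of]; rfl
    have hΘL : Θ.comp L = SemidirectProduct.inl := by
      ext1 i
      rw [MonoidHom.comp_apply, hLof]
      simp only [map_mul, map_inv, map_pow, hΘa, hΘx]
      rw [hXA, Fin.cast_val_eq_self]
    rw [injective_iff_map_eq_one]
    rintro ⟨w, k⟩ hp
    have h1 : Θ (L w) * Θ (Z k) = 1 := by
      rw [← map_mul, ← map_one Θ, ← hp, hψ]
    rw [← MonoidHom.comp_apply, hΘL, hZ, map_zpow, map_pow, hΘx, hX, ← map_zpow] at h1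
    have hl := congrArg SemidirectProduct.left h1
    have hr := congrArg SemidirectProduct.right h1
    rw [SemidirectProduct.mul_left, SemidirectProduct.left_inl, SemidirectProduct.left_inr,
      map_one, mul_one, SemidirectProduct.one_left] at hl
    rw [SemidirectProduct.mul_right, SemidirectProduct.right_inl, SemidirectProduct.right_inr,
      one_mul, ← ofAdd_zsmul, SemidirectProduct.one_right, ofAdd_eq_one, smul_eq_mul] at hr
    have hk : Multiplicative.toAdd k = 0 := by
      rcases mul_eq_zero.mp hr with h | h
      · exact h
      · omega
    exact Prod.ext hl (toAdd_eq_zero.mp hk)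
  let e0 : FreeGroup (Fin (m + 1)) × Multiplicative ℤ ≃* H :=
    (MonoidHom.ofInjective hinj).trans (MulEquiv.subgroupCongr hrange)
  exact ⟨e0.symm, hψx, hψb⟩
end

section
/- For every odd integer m ≥ 3, the dihedral Artin group D_m = ⟨a, b | (a,b)_m = (b,a)_m⟩ is isomorphic to the torus knot group ⟨x, y | x^m = y^2⟩, via an isomorphism sending the image of ab to x and the image of (b,a)_m to y. -/
/-- The torus knot group `⟨x, y ∣ xᵐ = y²⟩`; the generator `x` is `PresentedGroup.of 0` and
`y` is `PresentedGroup.of 1`. -/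
def torusRels (m : ℕ) : Set (FreeGroup (Fin 2)) :=
  {(FreeGroup.of 0) ^ m * ((FreeGroup.of 1) ^ 2)⁻¹}

theorem altProd_odd {G : Type*} [Monoid G] (u v : G) (k : ℕ) :
    altProd u v (2 * k + 1) = (u * v) ^ k * u := by
  induction k with
  | zero => simp [altProd]
  | succ k ih =>
    have h : altProd u v (2 * (k + 1) + 1) = altProd u v (2 * k + 1) * v * u := by
      unfold altProd
      rw [show 2 * (k + 1) + 1 = 2 * k + 1 + 1 + 1 by ring,
        List.range_succ, List.range_succ (n := 2 * k + 1)]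
      have h1 : (2 * k + 1) % 2 = 1 := by omega
      have h2 : (2 * k + 1 + 1) % 2 = 0 := by omega
      simp only [List.map_append, List.prod_append, List.map_cons, List.map_nil,
        List.prod_singleton, h1, h2]
      simp
    rw [h, ih, pow_succ]
    simp only [mul_assoc]

theorem alt_shift {G : Type*} [Monoid G] (u v : G) (k : ℕ) :
    (u * v) ^ k * u = u * (v * u) ^ k := by
  induction k with
  | zero => simp
  | succ k ih =>
    rw [pow_succ, pow_succ, ← mul_assoc u, ← ih]
    simp only [mul_assoc]

theorem torus_rel (m : ℕ) :
    (PresentedGroup.of 0 : PresentedGroup (torusRels m)) ^ m = PresentedGroup.of 1 ^ 2 := by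
  have h := PresentedGroup.one_of_mem (rels := torusRels m)
    (x := (FreeGroup.of 0) ^ m * ((FreeGroup.of 1) ^ 2)⁻¹) rfl
  rw [map_mul, map_inv, map_pow, map_pow, mul_inv_eq_one] at h
  exact h

theorem artin_rel (k : ℕ) :
    ((PresentedGroup.of 0 : DihedralArtin (2 * k + 1)) * PresentedGroup.of 1) ^ k
      * PresentedGroup.of 0
      = (PresentedGroup.of 1 * PresentedGroup.of 0) ^ k * PresentedGroup.of 1 := by
  have h := PresentedGroup.one_of_mem
    (rels := artinRels (⊤ : SimpleGraph (Fin 2)) (fun _ _ => 2 * k + 1))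
    (x := altProd (FreeGroup.of 0) (FreeGroup.of 1) (2 * k + 1) *
        (altProd (FreeGroup.of 1) (FreeGroup.of 0) (2 * k + 1))⁻¹) ⟨0, 1, by simp, rfl⟩
  rw [map_mul, map_inv, mul_inv_eq_one, altProd_odd, altProd_odd] at h
  simp only [map_mul, map_pow] at h
  exact h

/-- For odd `m ≥ 3`, the dihedral Artin group `D_m` is isomorphic to the torus
knot group `⟨x, y ∣ xᵐ = y²⟩` via `ab ↦ x` and `(b,a)_m ↦ y`. -/
theorem stmt_3 (m : ℕ) (hodd : Odd m) (hm : 3 ≤ m) :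
    ∃ e : DihedralArtin m ≃* PresentedGroup (torusRels m),
      e (PresentedGroup.of 0 * PresentedGroup.of 1) = PresentedGroup.of 0 ∧
      e (altProd (PresentedGroup.of 1) (PresentedGroup.of 0) m) = PresentedGroup.of 1 := by
  obtain ⟨k, rfl⟩ := hodd
  have ht := torus_rel (2 * k + 1)
  have ha := artin_rel k
  set x : PresentedGroup (torusRels (2 * k + 1)) := PresentedGroup.of 0 with hx
  set y : PresentedGroup (torusRels (2 * k + 1)) := PresentedGroup.of 1 with hy
  set a : DihedralArtin (2 * k + 1) := PresentedGroup.of 0 with hadef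
  set b : DihedralArtin (2 * k + 1) := PresentedGroup.of 1 with hbdef
  let f : Fin 2 → PresentedGroup (torusRels (2 * k + 1)) := ![x ^ (k + 1) * y⁻¹, y * (x ^ k)⁻¹]
  let g : Fin 2 → DihedralArtin (2 * k + 1) := ![a * b, (b * a) ^ k * b]
  have f0 : f 0 = x ^ (k + 1) * y⁻¹ := rfl
  have f1 : f 1 = y * (x ^ k)⁻¹ := rfl
  have f01 : f 0 * f 1 = x := by rw [f0, f1, pow_succ']; group
  have e1 : (f 1 * f 0) ^ k * f 1 = y := by
    rw [alt_shift, f01, f1]; group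
  have e0 : (f 0 * f 1) ^ k * f 0 = y := by
    rw [f01, f0, ← mul_assoc, ← pow_add, show k + (k + 1) = 2 * k + 1 by ring, ht]; group
  have hf : ∀ r ∈ artinRels (⊤ : SimpleGraph (Fin 2)) (fun _ _ => 2 * k + 1),
      FreeGroup.lift f r = 1 := by
    rintro r ⟨u, v, huv, rfl⟩
    rw [map_mul, map_inv, mul_inv_eq_one, altProd_odd, altProd_odd]
    simp only [map_mul, map_pow, FreeGroup.lift_apply_of]
    fin_cases u <;> fin_cases v
    · simp at huv
    · exact e0.trans e1.symm
    · exact e1.trans e0.symm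
    · simp at huv
  have hg : ∀ r ∈ torusRels (2 * k + 1), FreeGroup.lift g r = 1 := by
    rintro r rfl
    rw [map_mul, map_inv, mul_inv_eq_one]
    simp only [map_pow, FreeGroup.lift_apply_of]
    change (a * b) ^ (2 * k + 1) = ((b * a) ^ k * b) ^ 2
    rw [pow_two]
    nth_rewrite 1 [← ha]
    have hp : (a * b) ^ (2 * k + 1) = (a * b) ^ (k + 1 + k) :=
      congrArg (fun n : ℕ => (a * b) ^ n) (by ring)
    rw [alt_shift b a, hp, pow_add, pow_succ]
    simp only [mul_assoc]
  let F : DihedralArtin (2 * k + 1) →* PresentedGroup (torusRels (2 * k + 1)) :=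
    PresentedGroup.toGroup hf
  let G : PresentedGroup (torusRels (2 * k + 1)) →* DihedralArtin (2 * k + 1) :=
    PresentedGroup.toGroup hg
  have Fa : F a = f 0 := PresentedGroup.toGroup.of hf
  have Fb : F b = f 1 := PresentedGroup.toGroup.of hf
  have Gx : G x = a * b := PresentedGroup.toGroup.of hg
  have Gy : G y = (b * a) ^ k * b := PresentedGroup.toGroup.of hg
  have Gb : G (f 1) = b := by
    rw [f1, map_mul, map_inv, map_pow, Gx, Gy, alt_shift]; group
  have Ga : G (f 0) = a := by
    have : G (f 0) * G (f 1) = a * b := by rw [← map_mul, f01, Gx]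
    rw [Gb] at this
    exact mul_right_cancel this
  have h1 : G.comp F = MonoidHom.id _ := by
    apply PresentedGroup.ext
    intro i
    fin_cases i
    · change G (F a) = a
      rw [Fa, Ga]
    · change G (F b) = b
      rw [Fb, Gb]
  have h2 : F.comp G = MonoidHom.id _ := by
    apply PresentedGroup.ext
    intro i
    fin_cases i
    · change F (G x) = x
      rw [Gx, map_mul, Fa, Fb, f01]
    · change F (G y) = y
      rw [Gy, map_mul, map_pow, map_mul, Fa, Fb, e1]
  refine ⟨MonoidHom.toMulEquiv F G h1 h2, ?_, ?_⟩
  · change F (a * b) = x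
    rw [map_mul, Fa, Fb, f01]
  · change F (altProd b a (2 * k + 1)) = y
    rw [altProd_odd, map_mul, map_pow, map_mul, Fa, Fb, e1]
end

section
/- For every odd integer m ≥ 3, the dihedral Artin group D_m has a subgroup of index 2m that is isomorphic to ℤ × F_{m-1}, the direct product of the infinite cyclic group and a free group of rank m−1. -/
namespace DihArt

theorem altProd_odd {G : Type*} [Monoid G] (u v : G) (k : ℕ) :
    altProd u v (2 * k + 1) = (u * v) ^ k * u := by
  induction k with
  | zero => simp [altProd]
  | succ k ih =>
    have h : altProd u v (2 * (k + 1) + 1) = altProd u v (2 * k + 1) * v * u := by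
      unfold altProd
      rw [show 2 * (k + 1) + 1 = 2 * k + 1 + 1 + 1 by ring]
      rw [List.range_succ, List.range_succ (n := 2 * k + 1)]
      have h1 : (2 * k + 1) % 2 = 1 := by omega
      have h2 : (2 * k + 1 + 1) % 2 = 0 := by omega
      simp only [List.map_append, List.prod_append, List.map_cons, List.map_nil,
        List.prod_singleton, h1, h2]
      simp
    rw [h, ih, pow_succ]
    simp only [mul_assoc]

/-- A free group on at least two generators is centerless. -/
theorem free_center {ι : Type*} [DecidableEq ι] (hι : ∀ i : ι, ∃ j, j ≠ i) (w : FreeGroup ι)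
    (hw : ∀ i, Commute (FreeGroup.of i) w) : w = 1 := by
  by_contra hne
  have hnil : w.toWord ≠ [] := by simpa using hne
  obtain ⟨p, L, hL⟩ := List.exists_cons_of_ne_nil hnil
  obtain ⟨s, hs⟩ := hι p.1
  have hred : FreeGroup.IsReduced w.toWord := FreeGroup.isReduced_toWord
  obtain ⟨L', q, hL'⟩ : ∃ L' q, w.toWord = L' ++ [q] :=
    ⟨_, _, (List.dropLast_append_getLast hnil).symm⟩
  -- choose the sign
  obtain ⟨η, hη⟩ : ∃ η : Bool, q.1 = s → q.2 = η := ⟨q.2, fun _ => rfl⟩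
  have hcomm : FreeGroup.mk [(s, η)] * w = w * FreeGroup.mk [(s, η)] := by
    cases η with
    | true => exact hw s
    | false => exact (hw s).inv_left
  have h1 : FreeGroup.IsReduced ((s, η) :: w.toWord) := by
    rw [hL] at hred ⊢
    exact FreeGroup.isReduced_cons_cons.2 ⟨fun h => absurd h hs, hred⟩
  have h2 : FreeGroup.IsReduced (w.toWord ++ [(s, η)]) := by
    rw [hL'] at hred ⊢
    refine FreeGroup.IsReduced.append_overlap hred ?_ (by simp)
    exact FreeGroup.isReduced_cons_cons.2 ⟨hη, FreeGroup.IsReduced.singleton⟩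
  have h3 : (FreeGroup.mk [(s, η)] * w).toWord = (s, η) :: w.toWord := by
    conv_lhs => rw [← FreeGroup.mk_toWord (x := w)]
    rw [FreeGroup.mul_mk, FreeGroup.toWord_mk]
    exact h1.reduce_eq
  have h4 : (w * FreeGroup.mk [(s, η)]).toWord = w.toWord ++ [(s, η)] := by
    conv_lhs => rw [← FreeGroup.mk_toWord (x := w)]
    rw [FreeGroup.mul_mk, FreeGroup.toWord_mk]
    exact h2.reduce_eq
  rw [hcomm, h4, hL] at h3
  simp only [List.cons_append, List.cons.injEq] at h3
  exact hs (by rw [h3.1])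

section auto
variable (m : ℕ)

abbrev I := {j : ZMod m // j ≠ 0}

abbrev F := FreeGroup (I m)

def e (j : ZMod m) : F m := if h : j = 0 then 1 else FreeGroup.of ⟨j, h⟩

theorem e_zero : e m 0 = 1 := by simp [e]

theorem e_coe (j : I m) : e m j = FreeGroup.of j := by simp [e, j.2]

theorem hom_ext {G : Type*} [Group G] {f g : F m →* G} (h : ∀ j, f (e m j) = g (e m j)) :
    f = g := by
  ext j
  simpa [e_coe] using h j

noncomputable def A : F m →* F m := FreeGroup.lift fun j => (e m j)⁻¹

theorem A_e (j : ZMod m) : A m (e m j) = (e m j)⁻¹ := by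
  by_cases h : j = 0
  · subst h; simp [e_zero]
  · have := e_coe m ⟨j, h⟩
    simp only at this
    rw [this]
    simp [A, this]

noncomputable def B (i : ZMod m) : F m →* F m := FreeGroup.lift fun j => (e m i)⁻¹ * e m (i + j)

theorem B_e (i j : ZMod m) : B m i (e m j) = (e m i)⁻¹ * e m (i + j) := by
  by_cases h : j = 0
  · subst h; simp [e_zero]
  · have := e_coe m ⟨j, h⟩
    simp only at this
    conv_lhs => rw [this]
    simp [B]

theorem A_A (w : F m) : A m (A m w) = w := by
  have : (A m).comp (A m) = MonoidHom.id _ := hom_ext m fun j => by simp [A_e]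
  exact DFunLike.congr_fun this w

theorem B_B (i j : ZMod m) (w : F m) : B m i (B m j w) = B m (i + j) w := by
  have : (B m i).comp (B m j) = B m (i + j) := hom_ext m fun l => by
    simp [B_e, add_assoc]
  exact DFunLike.congr_fun this w

theorem B_zero (w : F m) : B m 0 w = w := by
  have : B m 0 = MonoidHom.id _ := hom_ext m fun j => by simp [B_e, e_zero]
  exact DFunLike.congr_fun this w

noncomputable def α : MulAut (F m) where
  toFun := A m
  invFun := A m
  left_inv := A_A m
  right_inv := A_A m
  map_mul' := map_mul _

noncomputable def β (i : ZMod m) : MulAut (F m) where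
  toFun := B m i
  invFun := B m (-i)
  left_inv w := by rw [B_B]; simp [B_zero]
  right_inv w := by rw [B_B]; simp [B_zero]
  map_mul' := map_mul _

theorem α_e (j : ZMod m) : α m (e m j) = (e m j)⁻¹ := A_e m j
theorem β_e (i j : ZMod m) : β m i (e m j) = (e m i)⁻¹ * e m (i + j) := B_e m i j
theorem α_α : α m * α m = 1 := MulEquiv.ext fun w => A_A m w
theorem β_β (i j : ZMod m) : β m i * β m j = β m (i + j) := MulEquiv.ext fun w => B_B m i j w
theorem β_zero : β m 0 = 1 := MulEquiv.ext fun w => B_zero m w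
theorem β_pow (n : ℕ) : β m 1 ^ n = β m n := by
  induction n with
  | zero => simp [β_zero]
  | succ n ih => rw [pow_succ, ih, β_β]; simp

theorem β_inv (i : ZMod m) : (β m i)⁻¹ = β m (-i) :=
  inv_eq_of_mul_eq_one_right (by rw [β_β]; simp [β_zero])

theorem comm_conj (j : ZMod m) : α m * β m j * (α m)⁻¹ * (β m j)⁻¹ = MulAut.conj (e m j) := by
  have hα : (α m)⁻¹ = α m := inv_eq_of_mul_eq_one_right (α_α m)
  rw [hα, β_inv]
  apply MulEquiv.toMonoidHom_injective
  apply hom_ext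
  intro l
  simp [β_e, α_e, e_zero, mul_assoc]

end auto

theorem core {D : Type} [Group D] (k m : ℕ) (hk : 1 ≤ k) (hm : m = 2 * k + 1) (x y : D)
    (hxy : x * x = y ^ m)
    (hgen : ∀ H : Subgroup D, x ∈ H → y ∈ H → ∀ g, g ∈ H)
    (huniv : ∀ (G : Type) [Group G] (u v : G), u * u = v ^ m →
      ∃ φ : D →* G, φ x = u ∧ φ y = v) :
    ∃ H : Subgroup D, H.index = 2 * m ∧
      Nonempty (H ≃* Multiplicative ℤ × FreeGroup (Fin (m - 1))) := by
  have hm0 : NeZero m := ⟨by omega⟩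
  -- the length map
  obtain ⟨len, lx, ly⟩ := huniv (Multiplicative ℤ) (.ofAdd (m : ℤ)) (.ofAdd 2)
    (by rw [← ofAdd_add, ← ofAdd_nsmul]; congr 1; simp; ring)
  -- the action
  obtain ⟨ρ, ρx, ρy⟩ := huniv (MulAut (F m)) (α m) (β m 1)
    (by rw [α_α, β_pow]; simp [β_zero])
  set z := y ^ m with hz
  have zcen : ∀ g, Commute z g := fun g => by
    have := hgen (Subgroup.centralizer {z}) (by
      rw [Subgroup.mem_centralizer_singleton_iff, ← hxy, mul_assoc]) (by
      rw [Subgroup.mem_centralizer_singleton_iff, hz, ← pow_succ, ← pow_succ']) g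
    exact (Subgroup.mem_centralizer_singleton_iff.1 this).symm
  let c : ℕ → D := fun n => x * y ^ n * x⁻¹ * (y ^ n)⁻¹
  have cmod : ∀ n, c n = c (n % m) := by
    intro n
    have h1 : y ^ n = z ^ (n / m) * y ^ (n % m) := by
      rw [hz, ← pow_mul, ← pow_add, Nat.div_add_mod]
    have h2 := ((zcen x).pow_left (n / m)).eq
    simp only [c]
    rw [h1, mul_inv_rev, ← mul_assoc, ← mul_assoc, ← h2]
    have h3 := ((zcen (x * y ^ (n % m) * x⁻¹ * (y ^ (n % m))⁻¹)).pow_left (n / m)).eq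
    simp only [mul_assoc] at h3 ⊢
    rw [← mul_assoc, ← mul_assoc, ← mul_assoc, ← mul_assoc]
    rw [mul_inv_eq_iff_eq_mul]
    simpa only [mul_assoc] using h3
  let f : F m →* D := FreeGroup.lift fun j => c (j : ZMod m).val
  have fe : ∀ n : ℕ, f (e m n) = c n := by
    intro n
    rw [cmod]
    by_cases h : (n : ZMod m) = 0
    · rw [h, e_zero, map_one]
      rw [ZMod.natCast_eq_zero_iff] at h
      rw [Nat.mod_eq_zero_of_dvd h]
      simp [c]
    · have := e_coe m ⟨n, h⟩
      simp only at this
      rw [this]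
      simp [f, ZMod.val_natCast]
  have fsurj : ∀ {f₁ f₂ : F m →* D}, (∀ n : ℕ, f₁ (e m n) = f₂ (e m n)) → f₁ = f₂ := by
    intro f₁ f₂ h
    apply hom_ext
    intro j
    simpa using h j.val
  have xinv : x⁻¹ = z⁻¹ * x := by rw [← hxy]; group
  -- conjugation
  have conjx : ∀ w, x * f w * x⁻¹ = f (α m w) := by
    intro w
    have : (MulAut.conj x).toMonoidHom.comp f = f.comp (α m).toMonoidHom := fsurj fun n => by
      simp only [MonoidHom.comp_apply, MulEquiv.coe_toMonoidHom, MulAut.conj_apply, α_e, map_inv, fe]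
      simp only [c]
      have h1 := (zcen (y ^ n)).eq
      rw [← hxy] at h1
      have h2 : x * (x * y ^ n * x⁻¹ * (y ^ n)⁻¹) * x⁻¹
        = (x * x * y ^ n) * x⁻¹ * (y ^ n)⁻¹ * x⁻¹ := by group
      rw [h2, h1]; group
    exact DFunLike.congr_fun this w
  have conjy : ∀ w, y * f w * y⁻¹ = f (β m 1 w) := by
    intro w
    have : (MulAut.conj y).toMonoidHom.comp f = f.comp (β m 1).toMonoidHom := fsurj fun n => by
      have h1 := fe 1
      have h2 := fe (1 + n)
      push_cast at h1 h2
      simp only [MonoidHom.comp_apply, MulEquiv.coe_toMonoidHom, MulAut.conj_apply, β_e, map_inv,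
        map_mul, fe, h1, h2]
      simp only [c]
      group
    exact DFunLike.congr_fun this w
  have conjg : ∀ g w, g * f w * g⁻¹ = f (ρ g w) := by
    intro g
    let S : Subgroup D :=
      { carrier := {g | ∀ w, g * f w * g⁻¹ = f (ρ g w)}
        mul_mem' := by
          intro g h hg hh w
          have : g * h * f w * (g * h)⁻¹ = g * (h * f w * h⁻¹) * g⁻¹ := by group
          rw [this, hh, hg, map_mul, MulAut.mul_apply]
        one_mem' := by intro w; simp
        inv_mem' := by
          intro g hg w
          have := hg ((ρ g)⁻¹ w)
          rw [MulAut.apply_inv_self] at this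
          rw [map_inv, ← this]
          group }
    exact hgen S (fun w => by rw [conjx, ρx]) (fun w => by rw [conjy, ρy]) g
  -- injectivity
  have ρf : ρ.comp f = MulAut.conj := by
    apply hom_ext
    intro j
    have h := fe j.val
    rw [ZMod.natCast_zmod_val] at h
    rw [MonoidHom.comp_apply, h]
    simp only [c, map_mul, map_inv, map_pow, ρx, ρy, β_pow, ZMod.natCast_zmod_val]
    exact comm_conj m j
  have cardI : Fintype.card (I m) = m - 1 := by
    rw [Fintype.card_subtype_compl, Fintype.card_subtype_eq, ZMod.card]
  have finj : ∀ w, f w = 1 → w = 1 := by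
    intro w hw
    apply free_center
    · intro i
      have : Nontrivial (I m) := Fintype.one_lt_card_iff_nontrivial.1 (by omega)
      exact exists_ne i
    · intro i
      have h1 := DFunLike.congr_fun ρf w
      rw [MonoidHom.comp_apply, hw, map_one] at h1
      have h2 := DFunLike.congr_fun h1 (FreeGroup.of i)
      rw [MulAut.one_apply, MulAut.conj_apply, eq_mul_inv_iff_mul_eq] at h2
      exact h2
  -- lengths
  have lf : ∀ w, len (f w) = 1 := by
    have : len.comp f = 1 := by
      apply hom_ext
      intro j
      have h := fe j.val
      rw [ZMod.natCast_zmod_val] at h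
      rw [MonoidHom.comp_apply, h]
      simp only [c, map_mul, map_inv]
      simp
    intro w
    exact DFunLike.congr_fun this w
  let a : D := (y ^ k)⁻¹ * x
  have la : len a = .ofAdd 1 := by
    simp only [a, map_mul, map_inv, map_pow, lx, ly]
    rw [← ofAdd_nsmul, ← ofAdd_neg, ← ofAdd_add]
    congr 1
    subst hm; simp; ring
  have lz : len z = .ofAdd (2 * m : ℤ) := by
    rw [hz, map_pow, ly, ← ofAdd_nsmul]
    congr 1; simp; ring
  have fnorm : ∀ g w, ∃ w', g * f w = f w' * g := fun g w =>
    ⟨ρ g w, by rw [← conjg]; group⟩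
  have rep : ∀ g, ∃ w, ∃ n : ℤ, g = f w * a ^ n := by
    let S : Subgroup D :=
      { carrier := {g | ∃ w, ∃ n : ℤ, g = f w * a ^ n}
        mul_mem' := by
          rintro _ _ ⟨w, n, rfl⟩ ⟨w', n', rfl⟩
          obtain ⟨v, hv⟩ := fnorm (a ^ n) w'
          refine ⟨w * v, n + n', ?_⟩
          rw [map_mul, zpow_add]
          have : f w * a ^ n * (f w' * a ^ n') = f w * (a ^ n * f w') * a ^ n' := by group
          rw [this, hv]; group
        one_mem' := ⟨1, 0, by simp⟩
        inv_mem' := by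
          rintro _ ⟨w, n, rfl⟩
          obtain ⟨v, hv⟩ := fnorm (a ^ (-n)) w⁻¹
          refine ⟨v, -n, ?_⟩
          rw [← hv, map_inv]
          group }
    have aS : a ∈ S := ⟨1, 1, by simp⟩
    have fS : ∀ w, f w ∈ S := fun w => ⟨w, 0, by simp⟩
    have yS : y ∈ S := by
      have : y = a * f (e m (k + 1 : ℕ)) * a := by
        rw [fe]
        have hzk : y ^ (k + 1) = (y ^ k)⁻¹ * z := by
          rw [hz, hm, two_mul, add_assoc, pow_add y k]; group
        have hxx : y ^ (k+1) = y ^ k * y := pow_succ _ _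
        simp only [a, c]
        have h1 : (y ^ k)⁻¹ * x * (x * y ^ (k + 1) * x⁻¹ * (y ^ (k + 1))⁻¹) * ((y ^ k)⁻¹ * x)
            = (y ^ k)⁻¹ * ((x * x) * y ^ (k + 1)) * x⁻¹ * (y ^ k * y ^ (k + 1))⁻¹ * x := by
              have : y ^ (k + 1) * y ^ k = y ^ k * y ^ (k + 1) := by
                rw [← pow_add, ← pow_add, add_comm]
              rw [← this]
              group
        have h2 : y ^ k * y ^ (k + 1) = z := by rw [hz, hm, ← pow_add]; congr 1; ring
        rw [h1, h2, hxy, (zcen _).eq, hxx]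
        have h3 : (y ^ k)⁻¹ * (y ^ k * y * z) * x⁻¹ * z⁻¹ * x = y * (z * x⁻¹) * z⁻¹ * x := by group
        rw [h3, (zcen _).eq]; group
      rw [this]
      exact S.mul_mem (S.mul_mem aS (fS _)) aS
    have xS : x ∈ S := by
      have : x = y ^ k * a := by simp [a]
      rw [this]
      exact S.mul_mem (S.pow_mem yS k) aS
    exact fun g => hgen S xS yS g
  have kerf : ∀ g, len g = 1 → ∃ w, g = f w := by
    intro g hg
    obtain ⟨w, n, rfl⟩ := rep g
    rw [map_mul, lf, map_zpow, la, one_mul, ← ofAdd_zsmul] at hg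
    have : n = 0 := by
      have := congrArg Multiplicative.toAdd hg
      simpa using this
    exact ⟨w, by simp [this]⟩
  -- the subgroup
  let zz : Multiplicative ℤ →* D := zpowersHom D z
  have hzz : ∀ n, zz n = z ^ n.toAdd := fun n => rfl
  let Φ : Multiplicative ℤ × F m →* D := MonoidHom.noncommCoprod zz f
    (fun n w => by rw [hzz]; exact (zcen _).zpow_left _)
  have hΦ : ∀ p, Φ p = z ^ p.1.toAdd * f p.2 := fun p => rfl
  have hm1 : (m : ℤ) ≠ 0 := by simpa using hm0.out
  have Φinj : Function.Injective Φ := by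
    rw [injective_iff_map_eq_one]
    rintro ⟨n, w⟩ h
    rw [hΦ] at h
    simp only at h
    have h1 := congrArg len h
    rw [map_mul, lf, map_zpow, lz, mul_one, map_one, ← ofAdd_zsmul] at h1
    have h2 : n.toAdd = 0 := by
      have := congrArg Multiplicative.toAdd h1
      simpa [hm0.out] using this
    rw [h2, zpow_zero, one_mul] at h
    rw [finj w h]
    have : n = 1 := h2
    rw [this]; rfl
  let q : Multiplicative ℤ →* Multiplicative (ZMod (2 * m)) :=
    (Int.castAddHom (ZMod (2 * m))).toMultiplicative
  have hq : ∀ n : ℤ, q (.ofAdd n) = .ofAdd (n : ZMod (2 * m)) := fun n => rfl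
  have hker : Φ.range = (q.comp len).ker := by
    ext g
    rw [MonoidHom.mem_range, MonoidHom.mem_ker, MonoidHom.comp_apply]
    constructor
    · rintro ⟨p, rfl⟩
      rw [hΦ, map_mul, lf, mul_one, map_zpow, lz, map_zpow, hq]
      have : ((2 * m : ℤ) : ZMod (2 * m)) = 0 := by
        have := ZMod.natCast_self (2 * m)
        push_cast at this ⊢
        exact this
      rw [this]; simp
    · intro h
      obtain ⟨n, hn⟩ : ∃ n : ℤ, len g = .ofAdd n := ⟨(len g).toAdd, rfl⟩
      rw [hn, hq] at h
      have h' : (n : ZMod (2 * m)) = 0 := h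
      rw [ZMod.intCast_zmod_eq_zero_iff_dvd] at h'
      obtain ⟨t, ht⟩ := h'
      obtain ⟨w, hw⟩ := kerf (z ^ (-t) * g) (by
        rw [map_mul, map_zpow, lz, hn, ht, ← ofAdd_zsmul, ← ofAdd_add, ← ofAdd_zero]
        congr 1; push_cast; simp; ring)
      refine ⟨(.ofAdd t, w), ?_⟩
      rw [hΦ, ← hw]
      simp
  refine ⟨Φ.range, ?_, ?_⟩
  · rw [hker, Subgroup.index_ker, MonoidHom.range_eq_top.2, Subgroup.card_top]
    · exact Nat.card_zmod _
    · intro t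
      obtain ⟨n, hn⟩ := ZMod.intCast_surjective t.toAdd
      refine ⟨a ^ n, ?_⟩
      rw [MonoidHom.comp_apply, map_zpow, la, ← ofAdd_zsmul, hq]
      simp [hn]
  · have eI : I m ≃ Fin (m - 1) := Fintype.equivFinOfCardEq cardI
    exact ⟨(MonoidHom.ofInjective Φinj).symm.trans
      (MulEquiv.prodCongr (MulEquiv.refl _) (FreeGroup.freeGroupCongr eI))⟩

end DihArt

/-- For every odd `m ≥ 3`, the dihedral Artin group `D_m` has a subgroup of
index `2m` isomorphic to `ℤ × F_{m-1}`. -/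
theorem stmt_4 (m : ℕ) (hodd : Odd m) (hm : 3 ≤ m) :
    ∃ H : Subgroup (DihedralArtin m), H.index = 2 * m ∧
      Nonempty (H ≃* Multiplicative ℤ × FreeGroup (Fin (m - 1))) := by
  obtain ⟨k, hk⟩ := hodd
  let a : DihedralArtin m := PresentedGroup.of 0
  let b : DihedralArtin m := PresentedGroup.of 1
  have map_alt : ∀ {G H : Type} [Group G] [Group H] (φ : G →* H) (u v : G),
      φ (altProd u v m) = altProd (φ u) (φ v) m := by
    intro G H _ _ φ u v
    rw [hk, DihArt.altProd_odd, DihArt.altProd_odd]; simp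
  have halt : ∀ {G : Type} [Group G] (u v : G), altProd u v m = (u * v) ^ k * u := by
    intro G _ u v
    rw [hk, DihArt.altProd_odd]
  have hpow : ∀ {G : Type} [Group G] (u : G), u ^ m = u ^ k * (u * u ^ k) := by
    intro G _ u
    rw [hk, two_mul, add_assoc, pow_add, pow_succ']
  have hrel : (a * b) ^ k * a = (b * a) ^ k * b := by
    have h : altProd a b m = altProd b a m := by
      have h1 : PresentedGroup.mk (artinRels (⊤ : SimpleGraph (Fin 2)) (fun _ _ => m))
          (altProd (FreeGroup.of 0) (FreeGroup.of 1) m) =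
          PresentedGroup.mk _ (altProd (FreeGroup.of 1) (FreeGroup.of 0) m) :=
        PresentedGroup.mk_eq_mk_of_mul_inv_mem ⟨0, 1, by simp, rfl⟩
      rw [map_alt, map_alt] at h1
      exact h1
    rwa [halt, halt] at h
  have hsh : ∀ n, b * (a * b) ^ n = (b * a) ^ n * b := by
    intro n
    induction n with
    | zero => simp
    | succ n ih => rw [pow_succ, ← mul_assoc, ih, pow_succ]; simp only [mul_assoc]
  refine DihArt.core k m (by omega) hk ((a * b) ^ k * a) (a * b) ?_ ?_ ?_
  · have h1 : (a * b) ^ k * a * ((a * b) ^ k * a) = (a * b) ^ k * a * (b * (a * b) ^ k) := by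
      rw [hsh, ← hrel]
    rw [h1, hpow]
    simp only [mul_assoc]
  · intro H hx hy g
    have ha : a ∈ H := by
      have := H.mul_mem (H.inv_mem (H.pow_mem hy k)) hx
      simpa using this
    have hb : b ∈ H := by
      have := H.mul_mem (H.inv_mem ha) hy
      simpa using this
    refine PresentedGroup.generated_by _ H ?_ g
    intro j
    fin_cases j
    · exact ha
    · exact hb
  · intro G _ u v huv
    let p : G := (v ^ k)⁻¹ * u
    let r : G := u⁻¹ * v ^ (k + 1)
    have hpr : p * r = v := by simp [p, r, pow_succ]
    have h1 : (p * r) ^ k * p = u := by rw [hpr]; simp [p]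
    have h2 : (r * p) ^ k * r = u := by
      have hrp : r * p = u⁻¹ * v * u⁻¹⁻¹ := by
        simp only [p, r, pow_succ']; group
      rw [hrp, conj_pow]
      have : u⁻¹ * v ^ k * u⁻¹⁻¹ * r = u⁻¹ * v ^ m := by
        simp only [r, hk, two_mul, add_assoc, pow_add]; group
      rw [this, ← huv]; group
    have h12 : altProd p r m = altProd r p m := by
      rw [hk, DihArt.altProd_odd, DihArt.altProd_odd, h1, h2]
    let φ : DihedralArtin m →* G := PresentedGroup.toGroup (f := ![p, r]) (by
      rintro _ ⟨i, j, hij, rfl⟩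
      rw [map_mul, map_inv, map_alt, map_alt, mul_inv_eq_one]
      fin_cases i <;> fin_cases j
      · simp at hij
      · simpa using h12
      · simpa using h12.symm
      · simp at hij)
    have φa : φ a = p := PresentedGroup.toGroup.of _
    have φb : φ b = r := PresentedGroup.toGroup.of _
    refine ⟨φ, ?_, ?_⟩
    · rw [map_mul, map_pow, map_mul, φa, φb, h1]
    · rw [map_mul, φa, φb, hpr]
end

section
/- For all integers p, q > 2, the right-angled Artin group A(C_4) ≅ F_2 × F_2 embeds as a subgroup into the Artin group A(S_p) and into the Artin group A(S_{p,q}). -/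
/-- Relations of the right-angled Artin group of a simplicial graph: commutators of adjacent vertices. -/
def raagRels {V : Type*} (G : SimpleGraph V) : Set (FreeGroup V) :=
  {r | ∃ u v : V, G.Adj u v ∧
    r = FreeGroup.of u * FreeGroup.of v * (FreeGroup.of u)⁻¹ * (FreeGroup.of v)⁻¹}

/-- The right-angled Artin group of a simplicial graph. -/
abbrev RAAG {V : Type*} (G : SimpleGraph V) := PresentedGroup (raagRels G)

/-- The graph underlying the chordal Artin squares `S_p` and `S_{p,q}` (without the diagonal
`{a,c}` for `S_p`): vertices `a = 0, b = 1, c = 2, d = 3`. The graph of `S_p` is the complete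
graph on four vertices minus the diagonal `{a, c} = {0, 2}`. -/
def SpGraph : SimpleGraph (Fin 4) :=
  (⊤ : SimpleGraph (Fin 4)).deleteEdges {s((0 : Fin 4), (2 : Fin 4))}

/-- Labels for `S_p`: the diagonal `{b, d} = {1, 3}` is labeled `p`, all square edges are
labeled `2`. -/
def SpLabel (p : ℕ) : Fin 4 → Fin 4 → ℕ := fun i j =>
  if (i = 1 ∧ j = 3) ∨ (i = 3 ∧ j = 1) then p else 2

/-- Labels for `S_{p,q}` (on the complete graph on four vertices): the diagonal `{b, d} = {1, 3}`
is labeled `p`, the diagonal `{a, c} = {0, 2}` is labeled `q`, and the square edges are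
labeled `2`. -/
def SpqLabel (p q : ℕ) : Fin 4 → Fin 4 → ℕ := fun i j =>
  if (i = 1 ∧ j = 3) ∨ (i = 3 ∧ j = 1) then p
  else if (i = 0 ∧ j = 2) ∨ (i = 2 ∧ j = 0) then q
  else 2

open Matrix UpperHalfPlane

/-- Upper unipotent. -/
def upM (x : ℝ) : Matrix.SpecialLinearGroup (Fin 2) ℝ :=
  ⟨!![1, x; 0, 1], by simp [Matrix.det_fin_two]⟩

/-- Lower unipotent. -/
def loM (x : ℝ) : Matrix.SpecialLinearGroup (Fin 2) ℝ :=
  ⟨!![1, 0; -x, 1], by simp [Matrix.det_fin_two]⟩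

lemma upM_mul (x y : ℝ) : upM x * upM y = upM (x + y) := by
  apply Subtype.ext
  change !![1, x; 0, 1] * !![1, y; 0, 1] = !![1, x + y; 0, 1]
  ext i j
  fin_cases i <;> fin_cases j <;> simp [Matrix.mul_apply, Fin.sum_univ_two, add_comm]

lemma loM_mul (x y : ℝ) : loM x * loM y = loM (x + y) := by
  apply Subtype.ext
  change !![1, 0; -x, 1] * !![1, 0; -y, 1] = !![1, 0; -(x + y), 1]
  ext i j
  fin_cases i <;> fin_cases j <;> simp [Matrix.mul_apply, Fin.sum_univ_two, add_comm]

lemma upM_inv (x : ℝ) : (upM x)⁻¹ = upM (-x) := by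
  apply inv_eq_of_mul_eq_one_right
  rw [upM_mul]
  ext i j
  fin_cases i <;> fin_cases j <;> simp [upM]

lemma loM_inv (x : ℝ) : (loM x)⁻¹ = loM (-x) := by
  apply inv_eq_of_mul_eq_one_right
  rw [loM_mul]
  ext i j
  fin_cases i <;> fin_cases j <;> simp [loM]

lemma upM_smul_re (x : ℝ) (z : ℍ) : (upM x • z).re = z.re + x := by
  have h := UpperHalfPlane.coe_specialLinearGroup_apply (upM x) z
  have h2 := congrArg Complex.re h
  simpa [upM] using h2

lemma lo_den_pos (x : ℝ) (z : ℍ) : 0 < (1 - x * z.re) ^ 2 + (x * z.im) ^ 2 := by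
  have hz := z.im_pos
  by_cases hx : x = 0
  · subst hx; norm_num
  · have : 0 < (x * z.im) ^ 2 := by positivity
    positivity

lemma loM_smul_re (x : ℝ) (z : ℍ) : (loM x • z).re * ((1 - x * z.re) ^ 2 + (x * z.im) ^ 2)
    = z.re - x * (z.re ^ 2 + z.im ^ 2) := by
  have h := UpperHalfPlane.coe_specialLinearGroup_apply (loM x) z
  have h2 := congrArg Complex.re h
  have hd := lo_den_pos x z
  have h3 : (loM x • z).re = (z.re - x * (z.re ^ 2 + z.im ^ 2)) /
      ((1 - x * z.re) ^ 2 + (x * z.im) ^ 2) := by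
    change ((loM x • z : ℍ) : ℂ).re = _
    rw [h2]
    simp only [loM, Complex.div_re, Complex.normSq_apply]
    simp
    rw [← add_div]
    congr 1 <;> ring
  rw [h3, div_mul_cancel₀ _ hd.ne']

lemma loM_smul_norm (x : ℝ) (z : ℍ) : ((loM x • z).re ^ 2 + (loM x • z).im ^ 2) *
    ((1 - x * z.re) ^ 2 + (x * z.im) ^ 2) = z.re ^ 2 + z.im ^ 2 := by
  have h := UpperHalfPlane.coe_specialLinearGroup_apply (loM x) z
  have hd := lo_den_pos x z
  have h2 := congrArg Complex.normSq h
  have h3 : (loM x • z).re ^ 2 + (loM x • z).im ^ 2 = (z.re ^ 2 + z.im ^ 2) /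
      ((1 - x * z.re) ^ 2 + (x * z.im) ^ 2) := by
    have e : (loM x • z).re ^ 2 + (loM x • z).im ^ 2
        = Complex.normSq ((loM x • z : ℍ) : ℂ) := by
      rw [Complex.normSq_apply]; simp [sq]
    rw [e, h2, Complex.normSq_div]
    simp only [loM, Complex.normSq_apply]
    simp
    congr 1 <;> ring
  rw [h3, div_mul_cancel₀ _ hd.ne']

lemma free_inj (m : ℝ) (hm : 2 ≤ m) :
    Function.Injective (FreeGroup.lift ![upM m, loM m]) := by
  apply FreeGroup.injective_lift_of_ping_pong (α := ℍ) ![upM m, loM m]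
    ![{z : ℍ | 1 ≤ z.re}, {z : ℍ | z.re ^ 2 + z.im ^ 2 ≤ - z.re}]
    ![{z : ℍ | z.re < -1}, {z : ℍ | z.re ^ 2 + z.im ^ 2 < z.re}]
  · intro i
    fin_cases i
    · exact ⟨⟨⟨1, 1⟩, by norm_num⟩, le_refl (1 : ℝ)⟩
    · exact ⟨⟨⟨-1/2, 1/2⟩, by norm_num⟩, by
        change (-1 / 2 : ℝ) ^ 2 + (1 / 2) ^ 2 ≤ -(-1 / 2)
        norm_num⟩
  · intro i j hij
    fin_cases i <;> fin_cases j <;> first | exact absurd rfl hij | skip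
    all_goals
      refine Set.disjoint_left.2 fun z h1 h2 => ?_
      have hz := z.im_pos
      simp at h1 h2
      nlinarith
  · intro i j hij
    fin_cases i <;> fin_cases j <;> first | exact absurd rfl hij | skip
    all_goals
      refine Set.disjoint_left.2 fun z h1 h2 => ?_
      have hz := z.im_pos
      simp at h1 h2
      nlinarith
  · intro i j
    fin_cases i <;> fin_cases j
    all_goals
      refine Set.disjoint_left.2 fun z h1 h2 => ?_
      have hz := z.im_pos
      simp at h1 h2
      nlinarith
  · intro i
    fin_cases i
    · rintro _ ⟨z, hz, rfl⟩
      simp at hz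
      simp [upM_smul_re]
      linarith
    · rintro _ ⟨z, hz, rfl⟩
      simp at hz
      have hd := lo_den_pos m z
      have h1 := loM_smul_re m z
      have h2 := loM_smul_norm m z
      have : 0 ≤ z.re ^ 2 + z.im ^ 2 := by positivity
      simp
      refine le_of_mul_le_mul_right ?_ hd
      rw [h2, neg_mul, h1]
      nlinarith
  · intro i
    fin_cases i
    · rintro _ ⟨z, hz, rfl⟩
      simp at hz
      simp [upM_inv, upM_smul_re]
      linarith
    · rintro _ ⟨z, hz, rfl⟩
      simp at hz
      have hd := lo_den_pos (-m) z
      have h1 := loM_smul_re (-m) z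
      have h2 := loM_smul_norm (-m) z
      have : 0 ≤ z.re ^ 2 + z.im ^ 2 := by positivity
      simp [loM_inv]
      refine lt_of_mul_lt_mul_right ?_ hd.le
      rw [h2, h1]
      nlinarith

lemma altProd_succ {G : Type*} [Monoid G] (u v : G) (n : ℕ) :
    altProd u v (n + 1) = altProd u v n * (if n % 2 = 0 then u else v) := by
  simp [altProd, List.range_succ]

lemma altProd_two {G : Type*} [Monoid G] (u v : G) : altProd u v 2 = u * v := by
  simp [altProd, List.range_succ]

lemma map_altProd {G H : Type*} [Monoid G] [Monoid H] (f : G →* H) (u v : G) (n : ℕ) :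
    f (altProd u v n) = altProd (f u) (f v) n := by
  induction n with
  | zero => simp [altProd]
  | succ n ih => rw [altProd_succ, altProd_succ, map_mul, ih]; split_ifs <;> rfl

lemma alt_even (θ : ℝ) (k : ℕ) :
    Real.sin θ • altProd (!![1, 2 * Real.cos θ; 0, 1] : Matrix (Fin 2) (Fin 2) ℝ)
      !![1, 0; -(2 * Real.cos θ), 1] (2 * k) =
    (-1 : ℝ) ^ k • !![Real.sin ((2 * k + 1) * θ), -Real.sin (2 * k * θ);
      Real.sin (2 * k * θ), -Real.sin ((2 * k - 1) * θ)] ∧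
    Real.sin θ • altProd (!![1, 0; -(2 * Real.cos θ), 1] : Matrix (Fin 2) (Fin 2) ℝ)
      !![1, 2 * Real.cos θ; 0, 1] (2 * k) =
    (-1 : ℝ) ^ k • !![-Real.sin ((2 * k - 1) * θ), -Real.sin (2 * k * θ);
      Real.sin (2 * k * θ), Real.sin ((2 * k + 1) * θ)] := by
  induction k with
  | zero =>
    constructor
    all_goals
      ext i j
      fin_cases i <;> fin_cases j <;> simp [altProd]
  | succ k ih =>
    have e : 2 * (k + 1) = 2 * k + 1 + 1 := by ring
    have m0 : (2 * k) % 2 = 0 := by omega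
    have m1 : (2 * k + 1) % 2 ≠ 0 := by omega
    have r (x : ℝ) : Real.sin (x + θ) = 2 * Real.cos θ * Real.sin x - Real.sin (x - θ) := by
      rw [Real.sin_add, Real.sin_sub]; ring
    have h2 : Real.sin ((2 * k + 1 : ℝ) * θ + θ) =
        2 * Real.cos θ * Real.sin ((2 * k + 1) * θ) - Real.sin (2 * k * θ) := by
      rw [r]; congr 2; ring
    have h1 : Real.sin ((2 * k + 1 : ℝ) * θ) =
        2 * Real.cos θ * Real.sin (2 * k * θ) - Real.sin ((2 * k - 1) * θ) := by
      have := r (2 * k * θ)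
      rw [show (2 * k + 1 : ℝ) * θ = 2 * k * θ + θ by ring, this]; congr 2; ring
    have h3 : Real.sin ((2 * k + 1 : ℝ) * θ + θ + θ) =
        2 * Real.cos θ * Real.sin ((2 * k + 1 : ℝ) * θ + θ) - Real.sin ((2 * k + 1) * θ) := by
      rw [r]; congr 2; ring
    have a1 : (2 * ((k + 1 : ℕ) : ℝ) + 1) * θ = (2 * k + 1 : ℝ) * θ + θ + θ := by
      push_cast; ring
    have a2 : 2 * ((k + 1 : ℕ) : ℝ) * θ = (2 * k + 1 : ℝ) * θ + θ := by
      push_cast; ring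
    have a3 : (2 * ((k + 1 : ℕ) : ℝ) - 1) * θ = (2 * k + 1 : ℝ) * θ := by
      push_cast; ring
    rw [e, altProd_succ, altProd_succ, altProd_succ, altProd_succ, if_pos m0, if_neg m1,
      if_pos m0, if_neg m1, a1, a2, a3, ← Matrix.smul_mul, ← Matrix.smul_mul,
      ← Matrix.smul_mul, ← Matrix.smul_mul, ih.1, ih.2, h3, h2]
    generalize Real.sin (2 * k * θ) = S0 at *
    generalize Real.sin ((2 * k + 1) * θ) = S1 at *
    have h1' : Real.sin ((2 * k - 1) * θ) = 2 * Real.cos θ * S0 - S1 := by linarith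
    rw [h1']
    constructor
    all_goals
      ext i j
      fin_cases i <;> fin_cases j <;>
        simp [Matrix.mul_apply, Fin.sum_univ_two, pow_succ] <;> ring

lemma braid (p : ℕ) (hp : 2 < p) :
    altProd (upM (2 * Real.cos (Real.pi / p))) (loM (2 * Real.cos (Real.pi / p))) p =
    altProd (loM (2 * Real.cos (Real.pi / p))) (upM (2 * Real.cos (Real.pi / p))) p := by
  have hp' : (2 : ℝ) < p := by exact_mod_cast hp
  obtain ⟨θ, hθ⟩ : ∃ θ, θ = Real.pi / p := ⟨_, rfl⟩
  have hpθ : (p : ℝ) * θ = Real.pi := by rw [hθ]; field_simp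
  rw [← hθ]
  have hs : Real.sin θ ≠ 0 := by
    apply ne_of_gt
    apply Real.sin_pos_of_pos_of_lt_pi
    · rw [hθ]; positivity
    · rw [hθ]; exact div_lt_self Real.pi_pos (by linarith)
  apply Subtype.ext
  have cm (u v : Matrix.SpecialLinearGroup (Fin 2) ℝ) (n : ℕ) :
      (altProd u v n).1 = altProd u.1 v.1 n := by
    induction n with
    | zero => simp [altProd]
    | succ n ih =>
      rw [altProd_succ, altProd_succ, ← ih]
      split_ifs <;> simp
  rw [cm, cm]
  apply smul_right_injective _ hs
  change Real.sin θ • altProd (!![1, 2 * Real.cos θ; 0, 1] : Matrix (Fin 2) (Fin 2) ℝ)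
      !![1, 0; -(2 * Real.cos θ), 1] p =
    Real.sin θ • altProd (!![1, 0; -(2 * Real.cos θ), 1] : Matrix (Fin 2) (Fin 2) ℝ)
      !![1, 2 * Real.cos θ; 0, 1] p
  rcases Nat.even_or_odd' p with ⟨k, rfl | rfl⟩
  · rw [(alt_even θ k).1, (alt_even θ k).2]
    push_cast at hpθ
    rw [add_mul, sub_mul, hpθ, one_mul, Real.sin_pi_sub, add_comm, Real.sin_add_pi]
  · have m0 : (2 * k) % 2 = 0 := by omega
    push_cast at hpθ
    rw [altProd_succ, altProd_succ, if_pos m0, if_pos m0, ← Matrix.smul_mul, ← Matrix.smul_mul,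
      (alt_even θ k).1, (alt_even θ k).2, hpθ]
    have a : (2 * k : ℝ) * θ = Real.pi - θ := by linarith
    have b : (2 * k - 1 : ℝ) * θ = Real.pi - 2 * θ := by linarith
    rw [a, b, Real.sin_pi_sub, Real.sin_pi_sub, Real.sin_two_mul, Real.sin_pi]
    ext i j
    fin_cases i <;> fin_cases j <;>
      simp [Matrix.mul_apply, Fin.sum_univ_two] <;> ring

lemma lam_ge (p : ℕ) (hp : 2 < p) : 1 ≤ 2 * Real.cos (Real.pi / p) := by
  have h : Real.cos (Real.pi / 3) ≤ Real.cos (Real.pi / p) := by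
    apply Real.cos_le_cos_of_nonneg_of_le_pi
    · positivity
    · linarith [Real.pi_pos]
    · apply div_le_div_of_nonneg_left Real.pi_pos.le (by norm_num)
      exact_mod_cast hp
  rw [Real.cos_pi_div_three] at h
  linarith

lemma main_embed {A : Type*} [Group A] (g : Fin 4 → A)
    (h01 : Commute (g 0) (g 1)) (h03 : Commute (g 0) (g 3))
    (h21 : Commute (g 2) (g 1)) (h23 : Commute (g 2) (g 3))
    (x y : ℝ) (hx : 1 ≤ x) (hy : 1 ≤ y)
    (φ : A →* Matrix.SpecialLinearGroup (Fin 2) ℝ × Matrix.SpecialLinearGroup (Fin 2) ℝ)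
    (e0 : φ (g 0) = (upM x, 1)) (e2 : φ (g 2) = (loM x, 1))
    (e1 : φ (g 1) = (1, upM y)) (e3 : φ (g 3) = (1, loM y)) :
    ∃ f : RAAG (SimpleGraph.cycleGraph 4) →* A, Function.Injective f := by
  have hc : ∀ u v : Fin 4, (SimpleGraph.cycleGraph 4).Adj u v → Commute (g u) (g v) := by
    intro u v huv
    fin_cases u <;> fin_cases v <;>
      first
      | exact absurd huv (by decide)
      | assumption
      | (apply Commute.symm; assumption)
  have hrel : ∀ r ∈ raagRels (SimpleGraph.cycleGraph 4),
      FreeGroup.lift (fun i => g i * g i) r = 1 := by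
    rintro r ⟨u, v, huv, rfl⟩
    have h := hc u v huv
    have h' : Commute (g u * g u) (g v * g v) :=
      (h.mul_left h).mul_right (h.mul_left h)
    simp only [map_mul, map_inv, FreeGroup.lift_apply_of]
    rw [h'.eq]; group
  let f : RAAG (SimpleGraph.cycleGraph 4) →* A := PresentedGroup.toGroup hrel
  have hf : ∀ i, f (PresentedGroup.of i) = g i * g i := fun i => PresentedGroup.toGroup.of hrel
  let o : Fin 4 → RAAG (SimpleGraph.cycleGraph 4) := fun i => PresentedGroup.of i
  have ho : ∀ u v : Fin 4, (SimpleGraph.cycleGraph 4).Adj u v → Commute (o u) (o v) := by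
    intro u v huv
    have : (PresentedGroup.mk (raagRels (SimpleGraph.cycleGraph 4))) (FreeGroup.of u * FreeGroup.of v
      * (FreeGroup.of u)⁻¹ * (FreeGroup.of v)⁻¹) = 1 :=
      PresentedGroup.one_of_mem ⟨u, v, huv, rfl⟩
    simp only [map_mul, map_inv] at this
    have h2 := mul_inv_eq_one.1 this
    exact mul_inv_eq_iff_eq_mul.1 h2
  let i : FreeGroup (Fin 2) →* RAAG (SimpleGraph.cycleGraph 4) := FreeGroup.lift ![o 0, o 2]
  let j : FreeGroup (Fin 2) →* RAAG (SimpleGraph.cycleGraph 4) := FreeGroup.lift ![o 1, o 3]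
  have hgen : ∀ (a b : Fin 2), Commute (![o 0, o 2] a) (![o 1, o 3] b) := by
    intro a b
    fin_cases a <;> fin_cases b <;> exact ho _ _ (by decide)
  have hij : ∀ u v, Commute (i u) (j v) := by
    intro u v
    induction u using FreeGroup.induction_on with
    | C1 => simp
    | of a =>
      induction v using FreeGroup.induction_on with
      | C1 => simp
      | of b => simpa [i, j] using hgen a b
      | inv_of b hb => rw [map_inv]; exact hb.inv_right
      | mul b c hb hc => rw [map_mul]; exact hb.mul_right hc
    | inv_of b hb => rw [map_inv]; exact hb.inv_left
    | mul b c hb hc => rw [map_mul]; exact hb.mul_left hc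
  let c := MonoidHom.noncommCoprod i j hij
  have hsurj : Function.Surjective c := by
    rw [← MonoidHom.range_eq_top, eq_top_iff, ← PresentedGroup.closure_range_of,
      Subgroup.closure_le]
    rintro _ ⟨k, rfl⟩
    fin_cases k
    · exact ⟨(FreeGroup.of 0, 1), by simp [c, i, o]⟩
    · exact ⟨(1, FreeGroup.of 0), by simp [c, j, o]⟩
    · exact ⟨(FreeGroup.of 1, 1), by simp [c, i, o]⟩
    · exact ⟨(1, FreeGroup.of 1), by simp [c, j, o]⟩
  have hcomp : ((φ.comp f).comp c) =
      (FreeGroup.lift ![upM (x + x), loM (x + x)]).prodMap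
        (FreeGroup.lift ![upM (y + y), loM (y + y)]) := by
    apply MonoidHom.ext
    suffices h : (∀ u, φ (f (i u)) = (FreeGroup.lift ![upM (x + x), loM (x + x)] u, 1)) ∧
        (∀ u, φ (f (j u)) = (1, FreeGroup.lift ![upM (y + y), loM (y + y)] u)) by
      rintro ⟨u, v⟩
      simp [c, h.1, h.2]
    constructor
    · have : (φ.comp f).comp i = (MonoidHom.inl _ _).comp
          (FreeGroup.lift ![upM (x + x), loM (x + x)]) := by
        apply FreeGroup.ext_hom
        intro a
        fin_cases a <;> simp [i, o, hf, e0, e2, upM_mul, loM_mul]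
      exact fun u => DFunLike.congr_fun this u
    · have : (φ.comp f).comp j = (MonoidHom.inr _ _).comp
          (FreeGroup.lift ![upM (y + y), loM (y + y)]) := by
        apply FreeGroup.ext_hom
        intro a
        fin_cases a <;> simp [j, o, hf, e1, e3, upM_mul, loM_mul]
      exact fun u => DFunLike.congr_fun this u
  have hinj : Function.Injective ((φ.comp f).comp c) := by
    rw [hcomp]
    exact Function.Injective.prodMap (free_inj _ (by linarith)) (free_inj _ (by linarith))
  refine ⟨f, fun a b hab => ?_⟩
  obtain ⟨a, rfl⟩ := hsurj a
  obtain ⟨b, rfl⟩ := hsurj b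
  congr 1
  apply hinj
  simp [hab]

lemma artin_embed (G : SimpleGraph (Fin 4)) (l : Fin 4 → Fin 4 → ℕ) (x y : ℝ)
    (hx : 1 ≤ x) (hy : 1 ≤ y)
    (hG : ∀ u v : Fin 4, (SimpleGraph.cycleGraph 4).Adj u v → G.Adj u v ∧ l u v = 2)
    (hx' : G.Adj 0 2 → altProd (upM x) (loM x) (l 0 2) = altProd (loM x) (upM x) (l 0 2))
    (hy' : G.Adj 1 3 → altProd (upM y) (loM y) (l 1 3) = altProd (loM y) (upM y) (l 1 3))
    (hl : ∀ u v, l u v = l v u) :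
    ∃ f : RAAG (SimpleGraph.cycleGraph 4) →* ArtinGroup G l, Function.Injective f := by
  let w : Fin 4 → Matrix.SpecialLinearGroup (Fin 2) ℝ × Matrix.SpecialLinearGroup (Fin 2) ℝ :=
    ![(upM x, 1), (1, upM y), (loM x, 1), (1, loM y)]
  have hinl (u v : Matrix.SpecialLinearGroup (Fin 2) ℝ) (n : ℕ)
      (h : altProd u v n = altProd v u n) :
      altProd (u, (1 : Matrix.SpecialLinearGroup (Fin 2) ℝ)) (v, 1) n
        = altProd (v, 1) (u, 1) n := by
    have := congrArg (MonoidHom.inl _ (Matrix.SpecialLinearGroup (Fin 2) ℝ)) h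
    simpa [map_altProd] using this
  have hinr (u v : Matrix.SpecialLinearGroup (Fin 2) ℝ) (n : ℕ)
      (h : altProd u v n = altProd v u n) :
      altProd ((1 : Matrix.SpecialLinearGroup (Fin 2) ℝ), u) (1, v) n
        = altProd (1, v) (1, u) n := by
    have := congrArg (MonoidHom.inr (Matrix.SpecialLinearGroup (Fin 2) ℝ) _) h
    simpa [map_altProd] using this
  have hw : ∀ u v, G.Adj u v → altProd (w u) (w v) (l u v) = altProd (w v) (w u) (l u v) := by
    intro u v huv
    by_cases hc : (SimpleGraph.cycleGraph 4).Adj u v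
    · rw [(hG u v hc).2, altProd_two, altProd_two]
      fin_cases u <;> fin_cases v <;> first | exact absurd hc (by decide) | simp [w]
    · fin_cases u <;> fin_cases v <;>
        first
        | exact absurd (by decide) hc
        | exact absurd huv (SimpleGraph.irrefl _)
        | exact hinl _ _ _ (hx' huv)
        | exact hinr _ _ _ (hy' huv)
        | skip
      · have := hinl _ _ _ (hx' huv.symm)
        rw [hl] at this
        exact this.symm
      · have := hinr _ _ _ (hy' huv.symm)
        rw [hl] at this
        exact this.symm
  have hrel : ∀ r ∈ artinRels G l, FreeGroup.lift w r = 1 := by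
    rintro r ⟨u, v, huv, rfl⟩
    rw [map_mul, map_inv, map_altProd, map_altProd, FreeGroup.lift_apply_of,
      FreeGroup.lift_apply_of, hw u v huv, mul_inv_cancel]
  have hcm : ∀ u v : Fin 4, (SimpleGraph.cycleGraph 4).Adj u v →
      Commute (PresentedGroup.of u : ArtinGroup G l) (PresentedGroup.of v) := by
    intro u v huv
    have h1 : (PresentedGroup.mk (artinRels G l)) _ = 1 :=
      PresentedGroup.one_of_mem ⟨u, v, (hG u v huv).1, rfl⟩
    rw [(hG u v huv).2, altProd_two, altProd_two, map_mul, map_inv, map_mul, map_mul] at h1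
    exact mul_inv_eq_one.1 h1
  have hof (k : Fin 4) : PresentedGroup.toGroup hrel (PresentedGroup.of k) = w k :=
    PresentedGroup.toGroup.of hrel
  exact main_embed (fun k => (PresentedGroup.of k : ArtinGroup G l))
    (hcm _ _ (by decide)) (hcm _ _ (by decide)) (hcm _ _ (by decide)) (hcm _ _ (by decide))
    x y hx hy (PresentedGroup.toGroup hrel) (hof 0) (hof 2) (hof 1) (hof 3)

/-- For `p, q > 2`, the right-angled Artin group `A(C₄) ≅ F₂ × F₂` embeds
into `A(S_p)` and into `A(S_{p,q})`. -/
theorem stmt_7 (p q : ℕ) (hp : 2 < p) (hq : 2 < q) :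
    (∃ f : RAAG (SimpleGraph.cycleGraph 4) →* ArtinGroup SpGraph (SpLabel p),
      Function.Injective f) ∧
    (∃ g : RAAG (SimpleGraph.cycleGraph 4) →*
        ArtinGroup (⊤ : SimpleGraph (Fin 4)) (SpqLabel p q),
      Function.Injective g) := by
  constructor
  · refine artin_embed SpGraph (SpLabel p) 1 (2 * Real.cos (Real.pi / p)) le_rfl (lam_ge p hp)
      ?_ ?_ ?_ ?_
    · intro u v huv
      fin_cases u <;> fin_cases v <;>
        first | exact absurd huv (by decide) | simp [SpGraph, SpLabel]
    · intro h
      simp [SpGraph] at h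
    · intro _
      simpa [SpLabel] using braid p hp
    · intro u v
      fin_cases u <;> fin_cases v <;> simp [SpLabel]
  · refine artin_embed ⊤ (SpqLabel p q) (2 * Real.cos (Real.pi / q))
      (2 * Real.cos (Real.pi / p)) (lam_ge q hq) (lam_ge p hp) ?_ ?_ ?_ ?_
    · intro u v huv
      fin_cases u <;> fin_cases v <;>
        first | exact absurd huv (by decide) | simp [SpqLabel]
    · intro _
      simpa [SpqLabel] using braid q hq
    · intro _
      simpa [SpqLabel] using braid p hp
    · intro u v
      fin_cases u <;> fin_cases v <;> simp [SpqLabel]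
end
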